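/- For n ≥ 3, β ∈ T_n, and 1 ≤ i ≤ n−1, f_{n+1}(ι^R(β)·t_{n,i}) = x^{2i}·f_n(β), where t_{n,i} = t_n t_{n−1} ⋯ t_{n−i+1} t_{n−i} t_{n−i+1} ⋯ t_{n−1} t_n. -/

import Mathlib

open Matrix Polynomial

/-- Deformed Tits matrix `V_i` (generator index `i` is 1-based, `1 ≤ i ≤ m`):
the identity `m × m` matrix except column `i`, which has `-1` on the diagonal,
`y` in row `i-1` and `x` in row `i+1`. -/
def Vmat {R : Type*} [CommRing R] (x y : R) (m i : ℕ) : Matrix (Fin m) (Fin m) R :=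
  Matrix.of fun r c =>
    if (c : ℕ) + 1 = i then
      if (r : ℕ) + 1 = i then -1
      else if (r : ℕ) + 2 = i then y
      else if (r : ℕ) = i then x
      else 0
    else if r = c then 1 else 0

/-- Relators of the twin group with `m` generators (the twin group on `m+1` strands). -/
def twinRels (m : ℕ) : Set (FreeGroup (Fin m)) :=
  {r | (∃ i, r = FreeGroup.of i * FreeGroup.of i) ∨
       (∃ i j : Fin m, (i : ℕ) + 1 < (j : ℕ) ∧
          r = FreeGroup.of i * FreeGroup.of j * (FreeGroup.of i)⁻¹ * (FreeGroup.of j)⁻¹)}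

/-- The twin group `T_{m+1}` on `m+1` strands, with `m` generators `t_1, …, t_m`;
the generator `t_{i+1}` is `TwinGroup.of i` for `i : Fin m`. -/
def TwinGroup (m : ℕ) : Type := PresentedGroup (twinRels m)

instance (m : ℕ) : Group (TwinGroup m) :=
  inferInstanceAs (Group (PresentedGroup (twinRels m)))

/-- The generator `t_{i+1}` of the twin group. -/
def TwinGroup.of {m : ℕ} (i : Fin m) : TwinGroup m := PresentedGroup.of i

/-- The field `ℤ(x)` of rational functions over `ℤ`. -/
noncomputable abbrev Zx : Type := FractionRing (Polynomial ℤ)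

/-- The element `x` of `ℤ(x)`. -/
noncomputable def xx : Zx := algebraMap (Polynomial ℤ) Zx Polynomial.X

/-- `U_n(1/x)` as an element of `ℤ(x)`, `U_n` the `n`-th Chebyshev polynomial
of the second kind. -/
noncomputable def Ux (n : ℕ) : Zx := Polynomial.eval xx⁻¹ (Polynomial.Chebyshev.U Zx n)

/-- The element `t_{n,i} = t_n t_{n−1} ⋯ t_{n−i+1} t_{n−i} t_{n−i+1} ⋯ t_{n−1} t_n`
of `T_{n+1}` (here `n = m+1`, so `t_{n,i} ∈ TwinGroup (m+1)` and `t_k = of (k-1)`). -/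
def tword (m i : ℕ) : TwinGroup (m+1) :=
  (List.ofFn fun j : Fin i => TwinGroup.of
      (⟨m - (j : ℕ), Nat.lt_succ_of_le (Nat.sub_le _ _)⟩ : Fin (m+1))).prod *
  TwinGroup.of (⟨m - i, Nat.lt_succ_of_le (Nat.sub_le _ _)⟩ : Fin (m+1)) *
  ((List.ofFn fun j : Fin i => TwinGroup.of
      (⟨m - (j : ℕ), Nat.lt_succ_of_le (Nat.sub_le _ _)⟩ : Fin (m+1))).reverse).prod

section DeformedTits

variable {R : Type*} [CommRing R]

/-- The negated Gram matrix of the deformed Tits form: `-2` on the diagonal and `x` next to it. -/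
def titsMatrix (x : R) (m : ℕ) : Matrix (Fin m) (Fin m) R :=
  Matrix.of fun r c =>
    if r = c then -2 else if (r : ℕ) + 1 = c ∨ (c : ℕ) + 1 = r then x else 0

theorem titsMatrix_transpose (x : R) (m : ℕ) : (titsMatrix x m)ᵀ = titsMatrix x m := by
  ext r c
  simp only [titsMatrix, transpose_apply, of_apply, eq_comm (a := c), or_comm]

theorem Vmat_eq (x : R) (m : ℕ) (k : Fin m) :
    Vmat x x m (k + 1) = 1 + titsMatrix x m * Matrix.single k k 1 := by
  ext r c
  by_cases hc : c = k
  · subst hc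
    simp only [Vmat, titsMatrix, Matrix.add_apply, of_apply, mul_single_apply_same,
      one_apply, Fin.ext_iff]
    split_ifs <;> first | omega | ring
  · have hc' : (c : ℕ) ≠ k := fun h => hc (Fin.ext h)
    rw [Matrix.add_apply, mul_single_apply_of_ne (hbj := hc)]
    simp [Vmat, one_apply, hc']

theorem titsMatrix_succ_eq_reindex (x : R) (m : ℕ) : ∃ B C D,
    titsMatrix x (m + 1) =
      reindex finSumFinEquiv finSumFinEquiv (fromBlocks (titsMatrix x m) B C D) := by
  set W := (titsMatrix x (m + 1)).submatrix (finSumFinEquiv (m := m) (n := 1)) finSumFinEquiv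
    with hW
  refine ⟨W.toBlocks₁₂, W.toBlocks₂₁, W.toBlocks₂₂, ?_⟩
  have h : titsMatrix x m = W.toBlocks₁₁ := by
    ext r c
    simp [hW, toBlocks₁₁, titsMatrix, Fin.ext_iff]
  rw [h, fromBlocks_toBlocks, hW]
  ext; simp

theorem titsMatrix_map {S : Type*} [CommRing S] (f : R →+* S) (x : R) (m : ℕ) :
    (titsMatrix x m).map f = titsMatrix (f x) m := by
  ext r c
  simp only [titsMatrix, map_apply, of_apply]
  split_ifs <;> simp [map_ofNat]

theorem det_titsMatrix_add_two (x : R) (m : ℕ) :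
    (titsMatrix x (m + 2)).det =
      -2 * (titsMatrix x (m + 1)).det - x ^ 2 * (titsMatrix x m).det := by
  have h0 : (titsMatrix x (m + 2)).submatrix Fin.succ (Fin.succAbove 0) =
      titsMatrix x (m + 1) := by
    ext r c
    simp [titsMatrix, Fin.ext_iff]
  have h1 : ((titsMatrix x (m + 2)).submatrix Fin.succ (Fin.succAbove 1)).det =
      x * (titsMatrix x m).det := by
    rw [det_succ_column_zero, Finset.sum_eq_single 0]
    · have h : ((titsMatrix x (m + 2)).submatrix Fin.succ (Fin.succAbove 1)).submatrix
          (Fin.succAbove 0) Fin.succ = titsMatrix x m := by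
        ext r c
        simp [titsMatrix, Fin.ext_iff]
      rw [h]
      simp [titsMatrix]
    · intro b _ hb
      have : (b : ℕ) ≠ 0 := fun h => hb (Fin.ext h)
      simp [titsMatrix, this, Fin.ext_iff]
    · simp
  rw [det_succ_row_zero, Fin.sum_univ_succ, Fin.sum_univ_succ, Finset.sum_eq_zero]
  · rw [h0, Fin.succ_zero_eq_one, h1]
    simp [titsMatrix]
    ring
  · intro j _
    simp [titsMatrix, Fin.ext_iff]

theorem det_reindex_fromBlocks_add_vecMulVec {m : ℕ} (P : Matrix (Fin m) (Fin m) R)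
    (v u : Fin (m + 1) → R) :
    (reindex finSumFinEquiv finSumFinEquiv (fromBlocks P 0 0 0) + vecMulVec v u).det =
      v (Fin.last m) * u (Fin.last m) * P.det := by
  have h : (reindex finSumFinEquiv finSumFinEquiv (fromBlocks P 0 0 0) + vecMulVec v u) =
      reindex (finSumFinEquiv (m := m) (n := 1)) finSumFinEquiv
        (fromBlocks P (of fun r _ => v r.castSucc) 0 (of fun _ _ => v (Fin.last m)) *
          fromBlocks 1 0 (of fun _ c => u c.castSucc) (of fun _ _ => u (Fin.last m))) := by
    apply (reindex finSumFinEquiv finSumFinEquiv).symm.injective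
    rw [Equiv.symm_apply_apply, fromBlocks_multiply]
    have hl (j : Fin 1) : Fin.natAdd m j = Fin.last m := by
      rw [Subsingleton.elim j 0]; rfl
    ext (r | r) (c | c) <;> simp [vecMulVec_apply, mul_apply, hl] <;> rfl
  rw [h, det_reindex_self, det_mul, det_fromBlocks_zero₂₁, det_fromBlocks_zero₁₂]
  simp
  ring

end DeformedTits

theorem TwinGroup.of_mul_self {m : ℕ} (k : Fin m) : TwinGroup.of k * TwinGroup.of k = 1 :=
  PresentedGroup.one_of_mem (rels := twinRels m) (Or.inl ⟨k, rfl⟩)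

theorem TwinGroup.induction_on {m : ℕ} {C : TwinGroup m → Prop} (β : TwinGroup m) (one : C 1)
    (of : ∀ k, C (TwinGroup.of k)) (mul : ∀ a b, C a → C b → C (a * b)) : C β := by
  obtain ⟨z, rfl⟩ := PresentedGroup.mk_surjective (twinRels m) β
  induction z using FreeGroup.induction_on with
  | C1 => exact one
  | of k => exact of k
  | inv_of k h =>
    have : PresentedGroup.mk (twinRels m) (FreeGroup.of k)⁻¹ = TwinGroup.of k :=
      inv_eq_of_mul_eq_one_left (TwinGroup.of_mul_self k)
    rw [this]
    exact of k
  | mul a b ha hb => exact mul _ _ ha hb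

section Representation

variable {R : Type*} [CommRing R] {x : R} {m : ℕ}

theorem exists_eq_one_add_titsMatrix_mul
    {ψ : TwinGroup m →* Matrix (Fin m) (Fin m) R}
    (hψ : ∀ k : Fin m, ψ (TwinGroup.of k) = Vmat x x m ((k : ℕ) + 1))
    {ψ' : TwinGroup (m + 1) →* Matrix (Fin (m + 1)) (Fin (m + 1)) R}
    (hψ' : ∀ k : Fin (m + 1), ψ' (TwinGroup.of k) = Vmat x x (m + 1) ((k : ℕ) + 1))
    {ι : TwinGroup m →* TwinGroup (m + 1)}
    (hι : ∀ k : Fin m, ι (TwinGroup.of k) = TwinGroup.of k.castSucc)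
    (β : TwinGroup m) : ∃ P : Matrix (Fin m) (Fin m) R,
      ψ β = 1 + titsMatrix x m * P ∧
      ψ' (ι β) = 1 + titsMatrix x (m + 1) *
        reindex finSumFinEquiv finSumFinEquiv (fromBlocks P 0 0 0) := by
  induction β using TwinGroup.induction_on with
  | one => exact ⟨0, by simp, by simp⟩
  | of k =>
    refine ⟨Matrix.single k k 1, by rw [hψ, Vmat_eq], ?_⟩
    rw [hι, hψ', Vmat_eq]
    congr 2
    apply (reindex finSumFinEquiv finSumFinEquiv).symm.injective
    rw [Equiv.symm_apply_apply]
    ext (r | r) (c | c) <;> simp [Matrix.single, Fin.ext_iff] <;> omega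
  | mul a b ha hb =>
    obtain ⟨P, hP, hP'⟩ := ha
    obtain ⟨Q, hQ, hQ'⟩ := hb
    refine ⟨P + Q + P * titsMatrix x m * Q, ?_, ?_⟩
    · rw [map_mul, hP, hQ]
      noncomm_ring
    · have h : reindex finSumFinEquiv finSumFinEquiv
            (fromBlocks (P + Q + P * titsMatrix x m * Q) 0 0 (0 : Matrix (Fin 1) (Fin 1) R)) =
          reindex finSumFinEquiv finSumFinEquiv (fromBlocks P 0 0 0) +
          reindex finSumFinEquiv finSumFinEquiv (fromBlocks Q 0 0 0) +
          reindex finSumFinEquiv finSumFinEquiv (fromBlocks P 0 0 0) * titsMatrix x (m + 1) *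
          reindex finSumFinEquiv finSumFinEquiv (fromBlocks Q 0 0 0) := by
        obtain ⟨B, C, D, hW⟩ := titsMatrix_succ_eq_reindex x m
        simp only [hW, reindex_apply, submatrix_mul_equiv, fromBlocks_multiply]
        ext r c
        simp only [Matrix.add_apply, submatrix_apply]
        rcases finSumFinEquiv.symm r with r | r <;> rcases finSumFinEquiv.symm c with c | c <;>
          simp
      rw [map_mul, map_mul, hP', hQ', h]
      noncomm_ring

theorem exists_conjugation_of_prod
    {ψ : TwinGroup (m + 1) →* Matrix (Fin (m + 1)) (Fin (m + 1)) R}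
    (hψ : ∀ k : Fin (m + 1), ψ (TwinGroup.of k) = Vmat x x (m + 1) ((k : ℕ) + 1))
    (i : ℕ) (hi : i ≤ m) : ∃ H : Matrix (Fin (m + 1)) (Fin (m + 1)) R,
      ψ (List.ofFn fun j : Fin i => TwinGroup.of
        (⟨m - (j : ℕ), Nat.lt_succ_of_le (Nat.sub_le _ _)⟩ : Fin (m+1))).prod *
          titsMatrix x (m + 1) = titsMatrix x (m + 1) * H ∧
      ψ (List.ofFn fun j : Fin i => TwinGroup.of
        (⟨m - (j : ℕ), Nat.lt_succ_of_le (Nat.sub_le _ _)⟩ : Fin (m+1))).reverse.prod = Hᵀ ∧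
      H (Fin.last m) ⟨m - i, by omega⟩ = x ^ i ∧
      ∀ c : Fin (m + 1), (c : ℕ) < m - i → H (Fin.last m) c = 0 := by
  induction i with
  | zero =>
    refine ⟨1, by simp, by simp, by simp [one_apply, Fin.ext_iff], fun c hc => ?_⟩
    rw [one_apply_ne]
    simp only [ne_eq, Fin.ext_iff, Fin.val_last]
    omega
  | succ i ih =>
    obtain ⟨H, h1, h2, h3, h4⟩ := ih (by omega)
    set k : Fin (m + 1) := ⟨m - i, by omega⟩ with hk
    set W := titsMatrix x (m + 1) with hW
    have key : ∀ c : Fin (m + 1),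
        (H * (1 + Matrix.single k k 1 * W) : Matrix _ _ R) (Fin.last m) c =
          H (Fin.last m) c + x ^ i * W k c := by
      intro c
      rw [mul_add, ← mul_assoc, mul_one, Matrix.add_apply, mul_apply, Finset.sum_eq_single k]
      · simp [h3]
      · intro b _ hb
        rw [mul_single_apply_of_ne (hbj := hb), zero_mul]
      · simp
    refine ⟨H * (1 + Matrix.single k k 1 * W), ?_, ?_, ?_, ?_⟩
    · simp only [List.ofFn_succ_last, List.prod_append, map_mul, List.prod_singleton, Fin.val_last,
        Fin.val_castSucc]
      rw [hψ, Vmat_eq, ← hk, ← hW, mul_assoc, add_mul, one_mul, mul_assoc, mul_add, h1,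
        ← mul_assoc, h1]
      noncomm_ring
    · simp only [List.ofFn_succ_last, List.reverse_append, List.prod_append, map_mul,
        List.reverse_singleton, List.prod_singleton, Fin.val_last, Fin.val_castSucc]
      rw [hψ, Vmat_eq, ← hk, ← hW, h2, transpose_mul, transpose_add, transpose_mul,
        hW, titsMatrix_transpose, transpose_one, transpose_single]
    · rw [key, h4 _ (by simp; omega), hW]
      simp only [titsMatrix, of_apply, hk, Fin.ext_iff]
      rw [if_neg (by omega), if_pos (by omega)]
      ring
    · intro c hc
      rw [key, h4 _ (by omega), hW]
      simp only [titsMatrix, of_apply, hk, Fin.ext_iff]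
      rw [if_neg (by omega), if_neg (by omega)]
      ring

theorem exists_map_tword_eq
    {ψ : TwinGroup (m + 1) →* Matrix (Fin (m + 1)) (Fin (m + 1)) R}
    (hψ : ∀ k : Fin (m + 1), ψ (TwinGroup.of k) = Vmat x x (m + 1) ((k : ℕ) + 1))
    (i : ℕ) (hi : i ≤ m) : ∃ u : Fin (m + 1) → R,
      ψ (tword m i) = 1 + titsMatrix x (m + 1) * vecMulVec u u ∧ u (Fin.last m) = x ^ i := by
  obtain ⟨H, h1, h2, h3, -⟩ := exists_conjugation_of_prod hψ i hi
  set L := List.ofFn fun j : Fin i => TwinGroup.of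
        (⟨m - (j : ℕ), Nat.lt_succ_of_le (Nat.sub_le _ _)⟩ : Fin (m+1)) with hL
  have hinv : L.prod * L.reverse.prod = 1 := by
    have : L.reverse.prod = L.prod⁻¹ := by
      rw [List.prod_inv_reverse]
      congr 2
      rw [hL, List.map_ofFn]
      congr 1
      ext j
      exact (inv_eq_of_mul_eq_one_left (TwinGroup.of_mul_self _)).symm
    rw [this, mul_inv_cancel]
  set k : Fin (m + 1) := ⟨m - i, by omega⟩ with hk
  refine ⟨H.col k, ?_, h3⟩
  have hu : vecMulVec (H.col k) (H.col k) = H * Matrix.single k k 1 * Hᵀ := by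
    ext r c
    rw [mul_apply, Finset.sum_eq_single k]
    · simp [vecMulVec_apply]
    · intro b _ hb
      rw [mul_single_apply_of_ne (hbj := hb), zero_mul]
    · simp
  have hprod : ψ L.prod * ψ L.reverse.prod = 1 := by rw [← map_mul, hinv, map_one]
  rw [tword, ← hL, ← hk, map_mul, map_mul, hψ, Vmat_eq, mul_add, mul_one, add_mul, hprod, hu, h2,
    ← mul_assoc, h1]
  simp only [mul_assoc]

theorem det_map_mul_tword_sub_one
    {ψ : TwinGroup m →* Matrix (Fin m) (Fin m) R}
    (hψ : ∀ k : Fin m, ψ (TwinGroup.of k) = Vmat x x m ((k : ℕ) + 1))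
    {ψ' : TwinGroup (m + 1) →* Matrix (Fin (m + 1)) (Fin (m + 1)) R}
    (hψ' : ∀ k : Fin (m + 1), ψ' (TwinGroup.of k) = Vmat x x (m + 1) ((k : ℕ) + 1))
    {ι : TwinGroup m →* TwinGroup (m + 1)}
    (hι : ∀ k : Fin m, ι (TwinGroup.of k) = TwinGroup.of k.castSucc)
    (β : TwinGroup m) {i : ℕ} (hi : i ≤ m) : ∃ p : R,
      (ψ β - 1).det = (titsMatrix x m).det * p ∧
      (ψ' (ι β * tword m i) - 1).det = (titsMatrix x (m + 1)).det * (x ^ (2 * i) * p) := by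
  obtain ⟨P, hP, hP'⟩ := exists_eq_one_add_titsMatrix_mul hψ hψ' hι β
  obtain ⟨u, hu, hux⟩ := exists_map_tword_eq hψ' i hi
  refine ⟨P.det, by rw [hP, add_sub_cancel_left, det_mul], ?_⟩
  set W := titsMatrix x (m + 1)
  set P' := reindex finSumFinEquiv finSumFinEquiv (fromBlocks P 0 0 (0 : Matrix (Fin 1) (Fin 1) R))
    with hPdef
  have hrow : ∀ c, P' (Fin.last m) c = 0 := by
    intro c
    have h : (finSumFinEquiv (m := m) (n := 1)).symm (Fin.last m) = Sum.inr 0 := by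
      rw [Equiv.symm_apply_eq]; rfl
    rw [hPdef, reindex_apply, submatrix_apply, h]
    rcases finSumFinEquiv.symm c with c | c <;> rfl
  have hfac : ψ' (ι β * tword m i) - 1 = W * (P' + vecMulVec (u + P' *ᵥ (W *ᵥ u)) u) := by
    rw [map_mul, hP', hu, add_vecMulVec, ← mul_vecMulVec, ← mul_vecMulVec]
    noncomm_ring
  have hlast : (P' *ᵥ (W *ᵥ u)) (Fin.last m) = 0 := by
    simp [mulVec, dotProduct, hrow]
  rw [hfac, det_mul, det_reindex_fromBlocks_add_vecMulVec, Pi.add_apply, hlast, hux]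
  ring

end Representation

theorem det_titsMatrix_eq_chebyshev {K : Type*} [Field K] {x : K} (hx : x ≠ 0) (m : ℕ) :
    (titsMatrix x m).det = (-x) ^ m * (Chebyshev.U K m).eval x⁻¹ := by
  induction m using Nat.twoStepInduction with
  | zero => simp
  | one =>
    simp [titsMatrix]
    field_simp
  | more m ih1 ih2 =>
    rw [det_titsMatrix_add_two, ih1, ih2]
    push_cast
    rw [Chebyshev.U_add_two]
    simp only [eval_sub, eval_mul, eval_ofNat, eval_X]
    field_simp
    ring

theorem det_titsMatrix_X_ne_zero (m : ℕ) : (titsMatrix (X : ℤ[X]) m).det ≠ 0 := by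
  intro h
  have h0 := congrArg (evalRingHom (0 : ℤ)) h
  have hd : titsMatrix (0 : ℤ) m = diagonal fun _ => -2 := by
    ext r c
    simp [titsMatrix, diagonal_apply]
  rw [RingHom.map_det, RingHom.mapMatrix_apply, titsMatrix_map, coe_evalRingHom, eval_X, hd,
    det_diagonal, eval_zero] at h0
  simp at h0

theorem xx_ne_zero : xx ≠ 0 :=
  (map_ne_zero_iff _ (IsFractionRing.injective ℤ[X] Zx)).mpr X_ne_zero

theorem det_titsMatrix_xx_ne_zero (m : ℕ) : (titsMatrix xx m).det ≠ 0 := by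
  rw [xx, ← titsMatrix_map, ← RingHom.mapMatrix_apply, ← RingHom.map_det]
  exact (map_ne_zero_iff _ (IsFractionRing.injective ℤ[X] Zx)).mpr (det_titsMatrix_X_ne_zero m)

/-- Lemma 4.9(a): for `n ≥ 3` (`n = m+1`), `β ∈ T_n` and `1 ≤ i ≤ n−1`,
`f_{n+1}(ι^R(β)·t_{n,i}) = x^{2i}·f_n(β)`. -/
theorem stmt16 (m : ℕ) (hm : 2 ≤ m) (i : ℕ) (hi1 : 1 ≤ i) (hi2 : i ≤ m)
    (ψ : TwinGroup m →* Matrix (Fin m) (Fin m) Zx)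
    (hψ : ∀ k : Fin m, ψ (TwinGroup.of k) = Vmat xx xx m ((k : ℕ) + 1))
    (ψ' : TwinGroup (m+1) →* Matrix (Fin (m+1)) (Fin (m+1)) Zx)
    (hψ' : ∀ k : Fin (m+1), ψ' (TwinGroup.of k) = Vmat xx xx (m+1) ((k : ℕ) + 1))
    (ιR : TwinGroup m →* TwinGroup (m+1))
    (hιR : ∀ k : Fin m, ιR (TwinGroup.of k) = TwinGroup.of k.castSucc)
    (β : TwinGroup m) :
    Matrix.det (ψ' (ιR β * tword m i) - 1) / ((-xx)^(m+1) * Ux (m+1))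
      = xx^(2*i) * (Matrix.det (ψ β - 1) / ((-xx)^m * Ux m)) := by
  obtain ⟨p, hp, hp'⟩ := det_map_mul_tword_sub_one hψ hψ' hιR β hi2
  rw [hp, hp', Ux, Ux, ← det_titsMatrix_eq_chebyshev xx_ne_zero,
    ← det_titsMatrix_eq_chebyshev xx_ne_zero,
    mul_div_cancel_left₀ _ (det_titsMatrix_xx_ne_zero _),
    mul_div_cancel_left₀ _ (det_titsMatrix_xx_ne_zero _)]
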